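/- Let Assumption (H) hold with E[‖A‖_HS^8] < ∞. Then d_TV(F,G) ≤ ((√3/(24√2))·(2√6+3√2+2+√d))^{1/2}·‖K^{-1}‖_HS·‖E[A]−K‖_HS + { [ (√2/(2λ(K)^4√3))·(2√6+3√2+2+√d)·‖K^{-1}‖_HS^2·(λ(K)^2+4‖K‖_HS^2) + (√70·d^2/(2λ(K)^4))·( (1/2)·max{ |log(2^d det K/(2‖K‖_op+λ(K))^d)|, log(2^d det K/λ(K)^d) } + (√2+1)d/4 ) + (3 + √3/8 + 5√10 + 4√30/3 + √15/3 + 10√5/3)·d^2/(2λ(K)^4) ]^{1/2} + 8/λ(K)^2 }·E[‖A−K‖_HS^8]^{1/4}. -/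

import Mathlib

open MeasureTheory ProbabilityTheory Matrix

noncomputable section

/-- Euclidean norm on `Fin d → ℝ`. -/
def euclNorm {d : ℕ} (x : Fin d → ℝ) : ℝ := Real.sqrt (∑ i, x i ^ 2)

/-- Hilbert–Schmidt norm of a matrix. -/
def hsNorm {d : ℕ} (M : Matrix (Fin d) (Fin d) ℝ) : ℝ := Real.sqrt (∑ i, ∑ j, M i j ^ 2)

/-- Operator norm of a matrix (w.r.t. the Euclidean norm). -/
def opNorm {d : ℕ} (M : Matrix (Fin d) (Fin d) ℝ) : ℝ :=
  sSup {r : ℝ | ∃ x : Fin d → ℝ, euclNorm x = 1 ∧ r = euclNorm (M.mulVec x)}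

/-- Smallest eigenvalue of a symmetric matrix (as the infimum of the Rayleigh quotient). -/
def lambdaMin {d : ℕ} (M : Matrix (Fin d) (Fin d) ℝ) : ℝ :=
  sInf {r : ℝ | ∃ x : Fin d → ℝ, euclNorm x = 1 ∧ r = x ⬝ᵥ M.mulVec x}

/-- Density of the centered Gaussian law `N_d(0, M)` on `ℝ^d`. -/
def gaussDensity {d : ℕ} (M : Matrix (Fin d) (Fin d) ℝ) (x : Fin d → ℝ) : ℝ :=
  (Real.sqrt ((2 * Real.pi) ^ d * M.det))⁻¹ * Real.exp (-(1/2) * (x ⬝ᵥ M⁻¹.mulVec x))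

/-- The centered Gaussian law `N_d(0, M)` on `ℝ^d` (for `M` positive definite). -/
def gaussLaw {d : ℕ} (M : Matrix (Fin d) (Fin d) ℝ) : Measure (Fin d → ℝ) :=
  volume.withDensity fun x => ENNReal.ofReal (gaussDensity M x)

/-- Relative entropy (Kullback–Leibler divergence) of `μ` with respect to `ν`. -/
def relEnt {E : Type*} [MeasurableSpace E] (μ ν : Measure E) : ℝ :=
  ∫ x, Real.log ((μ.rnDeriv ν x).toReal) ∂μ

/-- `F` is a centered, integrable random vector which is conditionally Gaussian with respect to
the σ-field `𝓕`, with conditional covariance matrix `A`. -/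
def CondGaussian {Ω : Type*} [MeasurableSpace Ω] (P : Measure Ω) {d : ℕ}
    (F : Ω → Fin d → ℝ) (𝓕 : MeasurableSpace Ω)
    (A : Ω → Matrix (Fin d) (Fin d) ℝ) : Prop :=
  Integrable F P ∧ (∫ ω, F ω ∂P) = 0 ∧
  (∀ ω, (A ω).PosSemidef) ∧
  Measurable[𝓕] (fun ω i j => A ω i j) ∧
  ∀ y : Fin d → ℝ,
    P[(fun ω => Complex.exp (Complex.I * ((y ⬝ᵥ F ω : ℝ) : ℂ))) | 𝓕] =ᵐ[P]
      fun ω => ((Real.exp (-(1/2) * (y ⬝ᵥ (A ω).mulVec y)) : ℝ) : ℂ)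

/-- The dimensional constant `2√6 + 3√2 + 2 + √d`. -/
def Cfac (d : ℕ) : ℝ := 2 * Real.sqrt 6 + 3 * Real.sqrt 2 + 2 + Real.sqrt d

/-- `max{ |log(2^d det K/(2‖K‖_op + λ(K))^d)| , log(2^d det K/λ(K)^d) }`. -/
def maxLog {d : ℕ} (K : Matrix (Fin d) (Fin d) ℝ) : ℝ :=
  max |Real.log ((2 ^ d * K.det) / ((2 * opNorm K + lambdaMin K) ^ d))|
      (Real.log ((2 ^ d * K.det) / (lambdaMin K ^ d)))


/-- Total variation distance between two measures. -/
def dTV {E : Type*} [MeasurableSpace E] (μ ν : Measure E) : ℝ :=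
  sSup {r : ℝ | ∃ B : Set E, MeasurableSet B ∧ r = |(μ B).toReal - (ν B).toReal|}

/-- 2-Wasserstein distance between two measures on `ℝ^d` (with the Euclidean cost). -/
def W2 {d : ℕ} (μ ν : Measure (Fin d → ℝ)) : ℝ :=
  sInf {r : ℝ | ∃ π : Measure ((Fin d → ℝ) × (Fin d → ℝ)), IsProbabilityMeasure π ∧
    π.map Prod.fst = μ ∧ π.map Prod.snd = ν ∧
    r = Real.sqrt (∫ p, (∑ i, (p.1 i - p.2 i) ^ 2) ∂π)}

end

section Aux
open scoped NNReal ENNReal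


/-- Density of `N(0,v)` with respect to `N(0,1)`. -/
noncomputable def fr (v : ℝ≥0) (z : ℝ) : ℝ := gaussianPDFReal 0 v z / gaussianPDFReal 0 1 z

lemma fr_nonneg (v : ℝ≥0) (z : ℝ) : 0 ≤ fr v z :=
  div_nonneg (gaussianPDFReal_nonneg _ _ _) (gaussianPDFReal_nonneg _ _ _)

@[fun_prop]
lemma fr_meas (v : ℝ≥0) : Measurable (fr v) :=
  (measurable_gaussianPDFReal 0 v).div (measurable_gaussianPDFReal 0 1)

lemma fr_mul (v : ℝ≥0) (z : ℝ) : gaussianPDFReal 0 1 z * fr v z = gaussianPDFReal 0 v z := by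
  unfold fr
  field_simp [(gaussianPDFReal_pos 0 1 z one_ne_zero).ne']

lemma integrable_fr {v : ℝ≥0} (hv : v ≠ 0) : Integrable (fr v) (gaussianReal 0 1) := by
  apply Integrable.of_integral_ne_zero
  rw [integral_gaussianReal_eq_integral_smul one_ne_zero]
  simp only [smul_eq_mul, fr_mul]
  rw [integral_gaussianPDFReal_eq_one 0 hv]; exact one_ne_zero

lemma withDensity_fr {v : ℝ≥0} (hv : v ≠ 0) :
    (gaussianReal 0 1).withDensity (fun z => ENNReal.ofReal (fr v z)) = gaussianReal 0 v := by
  rw [gaussianReal_of_var_ne_zero _ one_ne_zero, gaussianReal_of_var_ne_zero _ hv,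
    ← withDensity_mul _ (measurable_gaussianPDF 0 1) (fr_meas v).ennreal_ofReal]
  congr 1
  ext z
  simp only [Pi.mul_apply, gaussianPDF]
  rw [← ENNReal.ofReal_mul (gaussianPDFReal_nonneg _ _ _), fr_mul]

lemma integral_fr_sq (m : ℝ) (hm : |m| < 1) (v : ℝ≥0) (hv : (v : ℝ) = 1 + m) :
    ∫ z, (fr v z) ^ 2 ∂(gaussianReal 0 1) = (Real.sqrt (1 - m ^ 2))⁻¹ := by
  obtain ⟨h1, h2⟩ := abs_lt.1 hm
  have hvp : (0:ℝ) < 1 + m := by linarith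
  rw [integral_gaussianReal_eq_integral_smul one_ne_zero]
  have : ∀ z, gaussianPDFReal 0 1 z • (fr v z) ^ 2 =
      ((Real.sqrt (2 * Real.pi))⁻¹ * (1 + m)⁻¹) * Real.exp (-((1 - m) / (2 * (1 + m))) * z ^ 2) := by
    intro z
    have hp := gaussianPDFReal_pos 0 1 z one_ne_zero
    have e : gaussianPDFReal 0 1 z • (fr v z) ^ 2
        = gaussianPDFReal 0 v z ^ 2 / gaussianPDFReal 0 1 z := by
      simp only [fr, smul_eq_mul]; field_simp
    rw [e]
    simp only [gaussianPDFReal, hv, NNReal.coe_one, sub_zero, mul_one]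
    rw [mul_pow, ← Real.exp_nat_mul, inv_pow, Real.sq_sqrt (by positivity), mul_div_mul_comm,
      ← Real.exp_sub]
    have hs : Real.sqrt (2 * Real.pi) ^ 2 = 2 * Real.pi := Real.sq_sqrt (by positivity)
    congr 1
    · have : Real.sqrt (2 * Real.pi) ≠ 0 := by positivity
      field_simp
      exact hs
    · congr 1; field_simp; push_cast; ring
  simp_rw [this]
  rw [integral_const_mul, integral_gaussian]
  have hm2 : 0 < 1 - m := by linarith
  have : Real.pi / ((1 - m) / (2 * (1 + m))) = (2 * Real.pi) * ((1 + m) ^ 2 / (1 - m ^ 2)) := by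
    have : 1 - m ^ 2 = (1 - m) * (1 + m) := by ring
    rw [this]; field_simp
  rw [this, Real.sqrt_mul (x := 2 * Real.pi) (by positivity), Real.sqrt_div (by positivity), Real.sqrt_sq hvp.le]
  have : Real.sqrt (2 * Real.pi) ≠ 0 := by positivity
  field_simp

lemma integral_pow4 : ∫ z, z ^ 4 ∂(gaussianReal 0 1) = 3 := by
  rw [integral_gaussianReal_eq_integral_smul one_ne_zero]
  have h : ∀ z : ℝ, gaussianPDFReal 0 1 z • z ^ 4 = (Real.sqrt (2 * Real.pi))⁻¹ *
      ((fun x : ℝ => x ^ (4:ℝ) * Real.exp (-(1/2) * x ^ (2:ℝ))) |z|) := by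
    intro z
    have e1 : |z| ^ (4:ℝ) = z ^ 4 := by
      rw [show (4:ℝ) = ((4:ℕ):ℝ) by norm_num, Real.rpow_natCast, Even.pow_abs (by decide)]
    have e2 : |z| ^ (2:ℝ) = z ^ 2 := by
      rw [show (2:ℝ) = ((2:ℕ):ℝ) by norm_num, Real.rpow_natCast, Even.pow_abs (by decide)]
    simp only [e1, e2, gaussianPDFReal, NNReal.coe_one, sub_zero, mul_one, smul_eq_mul]
    rw [show -z ^ 2 / 2 = -(1/2) * z ^ 2 by ring]; ring
  simp_rw [h]
  rw [integral_const_mul, integral_comp_abs (f := fun x : ℝ => x ^ (4:ℝ) * Real.exp (-(1/2) * x ^ (2:ℝ))),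
    integral_rpow_mul_exp_neg_mul_rpow (by norm_num) (by norm_num) (by norm_num)]
  have g : Real.Gamma ((4 + 1) / 2) = 3 * Real.sqrt Real.pi / 4 := by
    have := Real.Gamma_nat_add_half 2
    rw [show ((2:ℕ):ℝ) + 1/2 = (4+1)/2 by norm_num] at this
    rw [this]; norm_num [Nat.doubleFactorial]
  rw [g]
  have r : ((1:ℝ)/2) ^ (-((4:ℝ)+1)/2) = 4 * Real.sqrt 2 := by
    rw [one_div, Real.inv_rpow (by norm_num), ← Real.rpow_neg (by norm_num),
      show -(-((4:ℝ)+1)/2) = ((2:ℕ):ℝ) + 1/2 by norm_num, Real.rpow_add (by norm_num),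
      Real.rpow_natCast, Real.sqrt_eq_rpow]; norm_num
  rw [r, Real.sqrt_mul (by norm_num)]
  have : Real.sqrt 2 ≠ 0 := by positivity
  have : Real.sqrt Real.pi ≠ 0 := by positivity
  field_simp

lemma integral_sq_gauss (v : ℝ≥0) : ∫ z, z ^ 2 ∂(gaussianReal 0 v) = v := by
  have h := variance_fun_id_gaussianReal (μ := 0) (v := v)
  rw [variance_of_integral_eq_zero (by fun_prop) (by simp)] at h
  simpa using h

lemma integrable_pow_gauss (v : ℝ≥0) (n : ℕ) : Integrable (fun z => z ^ n) (gaussianReal 0 v) := by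
  have := (memLp_id_gaussianReal (μ := 0) (v := v) n).integrable_norm_pow'
  refine this.mono' (by fun_prop) (ae_of_all _ fun z => by simp)

lemma memLp_h : MemLp (fun z : ℝ => z ^ 2 - 1) 2 (gaussianReal 0 1) := by
  rw [memLp_two_iff_integrable_sq (by fun_prop)]
  have : (fun z : ℝ => (z ^ 2 - 1) ^ 2) = fun z => z ^ 4 - 2 * z ^ 2 + 1 := by ext; ring
  rw [this]
  exact ((integrable_pow_gauss 1 4).sub ((integrable_pow_gauss 1 2).const_mul 2)).add
    (integrable_const _)

lemma integral_h_sq : ∫ z : ℝ, (z ^ 2 - 1) ^ 2 ∂(gaussianReal 0 1) = 2 := by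
  have : (fun z : ℝ => (z ^ 2 - 1) ^ 2) = fun z => z ^ 4 - 2 * z ^ 2 + 1 := by ext; ring
  have i2 := (integrable_pow_gauss 1 2).const_mul 2
  have i3 : Integrable (fun z : ℝ => z ^ 4 - 2 * z ^ 2) (gaussianReal 0 1) :=
    (integrable_pow_gauss 1 4).sub i2
  rw [this, integral_add i3 (integrable_const _), integral_sub (integrable_pow_gauss 1 4) i2,
    integral_pow4, integral_const_mul, integral_sq_gauss]
  norm_num

lemma integral_h (v : ℝ≥0) : ∫ z : ℝ, (z ^ 2 - 1) ∂(gaussianReal 0 v) = (v : ℝ) - 1 := by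
  rw [integral_sub (integrable_pow_gauss v 2) (integrable_const _), integral_sq_gauss]; simp


lemma pi_withDensity_real {ι : Type*} [Fintype ι] {E : Type*} [MeasurableSpace E] (μ : ι → Measure E)
    [∀ i, SigmaFinite (μ i)] (f : ι → E → ℝ) (h0 : ∀ i x, 0 ≤ f i x) (hf : ∀ i, Integrable (f i) (μ i))
    (ν : ι → Measure E) [∀ i, SigmaFinite (ν i)]
    (hν : ∀ i, (μ i).withDensity (fun x => ENNReal.ofReal (f i x)) = ν i) :
    (Measure.pi μ).withDensity (fun x => ENNReal.ofReal (∏ i, f i (x i))) = Measure.pi ν := by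
  symm
  apply Measure.pi_eq
  intro s hs
  have hS : MeasurableSet (Set.univ.pi s) := MeasurableSet.univ_pi hs
  rw [withDensity_apply _ hS, ← lintegral_indicator hS]
  have hg : ∀ i, Integrable ((s i).indicator (f i)) (μ i) := fun i => (hf i).indicator (hs i)
  have e : ∀ x : ι → E, (Set.univ.pi s).indicator (fun x => ENNReal.ofReal (∏ i, f i (x i))) x
      = ENNReal.ofReal (∏ i, (s i).indicator (f i) (x i)) := by
    intro x
    by_cases hx : x ∈ Set.univ.pi s
    · rw [Set.indicator_of_mem hx]
      congr 1
      exact Finset.prod_congr rfl fun i _ => (Set.indicator_of_mem (hx i trivial) _).symm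
    · rw [Set.indicator_of_notMem hx]
      simp only [Set.mem_univ_pi, not_forall] at hx
      obtain ⟨i, hi⟩ := hx
      rw [Finset.prod_eq_zero (Finset.mem_univ i) (Set.indicator_of_notMem hi _), ENNReal.ofReal_zero]
  simp_rw [e]
  have hn : ∀ i x, 0 ≤ (s i).indicator (f i) x := fun i x => Set.indicator_nonneg (fun x _ => h0 i x) x
  rw [← ofReal_integral_eq_lintegral_ofReal (Integrable.fintype_prod hg)
    (ae_of_all _ fun x => Finset.prod_nonneg fun i _ => hn i _),
    integral_fintype_prod_eq_prod, ENNReal.ofReal_prod_of_nonneg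
      (fun i _ => integral_nonneg (hn i))]
  refine Finset.prod_congr rfl fun i _ => ?_
  rw [← hν, withDensity_apply _ (hs i), ofReal_integral_eq_lintegral_ofReal (hg i)
    (ae_of_all _ (hn i)), ← lintegral_indicator (hs i)]
  congr 1
  ext x
  by_cases hx : x ∈ s i <;> simp [hx]

/-- Standard Gaussian measure on `Fin d → ℝ`. -/
noncomputable def gam (d : ℕ) : Measure (Fin d → ℝ) := Measure.pi fun _ => gaussianReal 0 1

instance (d : ℕ) : IsProbabilityMeasure (gam d) := by unfold gam; infer_instance

/-- Diagonal quadratic form. -/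
noncomputable def qd {d : ℕ} (m : Fin d → ℝ) (z : Fin d → ℝ) : ℝ := ∑ i, (m i / 2) * (z i ^ 2 - 1)

lemma l1_le_l2 {α : Type*} [MeasurableSpace α] (μ : Measure α) [IsProbabilityMeasure μ] (r : α → ℝ)
    (hr : MemLp r 2 μ) (B : Set α) : |∫ x in B, r x ∂μ| ≤ Real.sqrt (∫ x, r x ^ 2 ∂μ) := by
  have hi : Integrable r μ := hr.integrable (by norm_num)
  apply Real.le_sqrt_of_sq_le
  rw [sq_abs]
  have h1 : |∫ x in B, r x ∂μ| ≤ ∫ x, |r x| ∂μ :=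
    (abs_integral_le_integral_abs).trans
      (setIntegral_le_integral hi.abs (ae_of_all _ fun x => abs_nonneg _))
  have h2 : (∫ x, |r x| ∂μ) ^ 2 ≤ ∫ x, r x ^ 2 ∂μ := by
    have := variance_nonneg (fun x => |r x|) μ
    rw [variance_eq_sub (X := fun x => |r x|) hr.abs] at this
    simpa using this
  calc _ = |∫ x in B, r x ∂μ| ^ 2 := (sq_abs _).symm
    _ ≤ (∫ x, |r x| ∂μ) ^ 2 := by gcongr
    _ ≤ _ := h2

lemma memLp_comp_eval {d : ℕ} (i : Fin d) {f : ℝ → ℝ} {p : ℝ≥0∞} (hf : MemLp f p (gaussianReal 0 1)) :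
    MemLp (fun z : Fin d → ℝ => f (z i)) p (gam d) :=
  hf.comp_measurePreserving (measurePreserving_eval (fun _ : Fin d => gaussianReal 0 1) i)

lemma memLp_qd {d : ℕ} (m : Fin d → ℝ) : MemLp (qd m) 2 (gam d) := by
  unfold qd
  apply memLp_finsetSum
  intro i _
  exact (memLp_comp_eval i memLp_h).const_mul _

lemma integral_qd {d : ℕ} (v : Fin d → ℝ≥0) (m : Fin d → ℝ) :
    Integrable (qd m) (Measure.pi fun i => gaussianReal 0 (v i)) ∧
    ∫ z, qd m z ∂(Measure.pi fun i => gaussianReal 0 (v i)) = ∑ i, (m i / 2) * (v i - 1) := by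
  have hi : ∀ i, Integrable (fun z : Fin d → ℝ => (m i / 2) * (z i ^ 2 - 1))
      (Measure.pi fun i => gaussianReal 0 (v i)) := fun i =>
    ((measurePreserving_eval (fun i : Fin d => gaussianReal 0 (v i)) i).integrable_comp_of_integrable
      ((integrable_pow_gauss (v i) 2).sub (integrable_const 1))).const_mul _
  unfold qd
  refine ⟨integrable_finsetSum _ fun i _ => hi i, ?_⟩
  rw [integral_finsetSum _ fun i _ => hi i]
  refine Finset.sum_congr rfl fun i _ => ?_
  rw [integral_const_mul, ← integral_h]
  congr 1
  conv_rhs => rw [← (measurePreserving_eval (fun i : Fin d => gaussianReal 0 (v i)) i).map_eq]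
  rw [integral_map (measurable_pi_apply i).aemeasurable (by fun_prop)]

lemma integral_qd_gam {d : ℕ} (m : Fin d → ℝ) : ∫ z, qd m z ∂(gam d) = 0 := by
  rw [gam, (integral_qd (fun _ => 1) m).2]; simp

lemma integral_qd_sq {d : ℕ} (m : Fin d → ℝ) : ∫ z, qd m z ^ 2 ∂(gam d) = (∑ i, m i ^ 2) / 2 := by
  have h1 : Var[qd m; gam d] = ∫ z, qd m z ^ 2 ∂(gam d) := by
    rw [variance_of_integral_eq_zero (memLp_qd m).1.aemeasurable (integral_qd_gam m)]
  rw [← h1]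
  have h2 := variance_sum_pi (μ := fun _ : Fin d => gaussianReal 0 1)
    (X := fun i z => (m i / 2) * (z ^ 2 - 1)) (fun i => memLp_h.const_mul _)
  have h3 : qd m = ∑ i, fun z : Fin d → ℝ => (m i / 2) * (z i ^ 2 - 1) := by
    ext z; simp [qd]
  rw [h3, gam, h2, Finset.sum_div]
  refine Finset.sum_congr rfl fun i _ => ?_
  rw [variance_const_mul, variance_of_integral_eq_zero (by fun_prop) (by rw [integral_h]; simp),
    integral_h_sq]
  ring

lemma diag_q {d : ℕ} (m : Fin d → ℝ) (B : Set (Fin d → ℝ)) :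
    |∫ z in B, qd m z ∂(gam d)| ≤ Real.sqrt ((∑ i, m i ^ 2) / 2) := by
  rw [← integral_qd_sq]
  exact l1_le_l2 _ _ (memLp_qd m) B

lemma prod_bound {d : ℕ} (m : Fin d → ℝ) (hs : ∑ i, m i ^ 2 ≤ 1 / 4) :
    ∏ i, (Real.sqrt (1 - m i ^ 2))⁻¹ ≤ 1 + (∑ i, m i ^ 2) / 2 + 4 * (∑ i, m i ^ 2) ^ 2 := by
  set s := ∑ i, m i ^ 2 with hsd
  have h0 : 0 ≤ s := Finset.sum_nonneg fun i _ => sq_nonneg _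
  have hle : ∀ i, m i ^ 2 ≤ s := fun i =>
    Finset.single_le_sum (f := fun i => m i ^ 2) (fun i _ => sq_nonneg _) (Finset.mem_univ i)
  have hb : ∀ t : Finset (Fin d), 1 - ∑ i ∈ t, m i ^ 2 ≤ ∏ i ∈ t, (1 - m i ^ 2) ∧
      ∏ i ∈ t, (1 - m i ^ 2) ≤ 1 := by
    intro t
    induction t using Finset.induction_on with
    | empty => simp
    | insert a t ha ih =>
      rw [Finset.prod_insert ha, Finset.sum_insert ha]
      have := hle a
      have h2 := sq_nonneg (m a)
      have h3 : 0 ≤ ∏ i ∈ t, (1 - m i ^ 2) := Finset.prod_nonneg fun i _ => by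
        have := hle i; linarith
      constructor <;> nlinarith [ih.1, ih.2]
  have hb := (hb Finset.univ).1
  rw [← hsd] at hb
  rw [Finset.prod_inv_distrib]
  have hp : 0 < ∏ i, Real.sqrt (1 - m i ^ 2) := Finset.prod_pos fun i _ => by
    have := hle i; apply Real.sqrt_pos.2; linarith
  have hq : (∏ i, Real.sqrt (1 - m i ^ 2)) ^ 2 = ∏ i, (1 - m i ^ 2) := by
    rw [← Finset.prod_pow]
    refine Finset.prod_congr rfl fun i _ => Real.sq_sqrt ?_
    have := hle i; linarith
  rw [inv_le_iff_one_le_mul₀ hp]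
  set p := ∏ i, Real.sqrt (1 - m i ^ 2)
  have hA : 0 ≤ (1 + s / 2 + 4 * s ^ 2) * p := by positivity
  have : 1 ≤ ((1 + s / 2 + 4 * s ^ 2) * p) ^ 2 := by
    rw [mul_pow, hq]
    calc (1:ℝ) ≤ (1 + s / 2 + 4 * s ^ 2) ^ 2 * (1 - s) := by
          have : 1 + s + 8 * s ^ 2 ≤ (1 + s / 2 + 4 * s ^ 2) ^ 2 := by
            nlinarith [pow_nonneg h0 3, pow_nonneg h0 4]
          have h4 : (1 + s + 8 * s ^ 2) * (1 - s) ≤ (1 + s / 2 + 4 * s ^ 2) ^ 2 * (1 - s) :=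
            mul_le_mul_of_nonneg_right this (by linarith)
          nlinarith [mul_nonneg (sq_nonneg s) (by linarith : (0:ℝ) ≤ 7 - 8 * s)]
      _ ≤ _ := by gcongr
  nlinarith

lemma diag_good {d : ℕ} (m : Fin d → ℝ) (hs : ∑ i, m i ^ 2 ≤ 1 / 4) (v : Fin d → ℝ≥0)
    (hv : ∀ i, (v i : ℝ) = 1 + m i) (B : Set (Fin d → ℝ)) (hB : MeasurableSet B) :
    |(Measure.pi fun i => gaussianReal 0 (v i)).real B - (gam d).real B - ∫ z in B, qd m z ∂(gam d)|
      ≤ 2 * ∑ i, m i ^ 2 := by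
  set s := ∑ i, m i ^ 2 with hsd
  have h0 : 0 ≤ s := Finset.sum_nonneg fun i _ => sq_nonneg _
  have hle : ∀ i, m i ^ 2 ≤ s := fun i =>
    Finset.single_le_sum (f := fun i => m i ^ 2) (fun i _ => sq_nonneg _) (Finset.mem_univ i)
  have hm : ∀ i, |m i| < 1 := fun i => by
    rw [← sq_lt_one_iff_abs_lt_one]; have := hle i; linarith
  have hv0 : ∀ i, v i ≠ 0 := fun i h => by
    have := hv i; rw [h] at this; have := abs_lt.1 (hm i); simp at *; linarith
  set g : (Fin d → ℝ) → ℝ := fun z => ∏ i, fr (v i) (z i) with hg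
  have hgm : Measurable g := by fun_prop
  have hg0 : ∀ z, 0 ≤ g z := fun z => Finset.prod_nonneg fun i _ => fr_nonneg _ _
  have hν : (gam d).withDensity (fun z => ENNReal.ofReal (g z))
      = Measure.pi fun i => gaussianReal 0 (v i) :=
    pi_withDensity_real _ _ (fun i => fr_nonneg _) (fun i => integrable_fr (hv0 i)) _
      (fun i => withDensity_fr (hv0 i))
  have hintg : ∀ f : (Fin d → ℝ) → ℝ, ∫ z, f z ∂(Measure.pi fun i => gaussianReal 0 (v i))
      = ∫ z, g z * f z ∂(gam d) := by
    intro f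
    rw [← hν, integral_withDensity_eq_integral_toReal_smul (by fun_prop) (by simp)]
    simp [ENNReal.toReal_ofReal (hg0 _)]
  have hgi : Integrable g (gam d) := Integrable.fintype_prod fun i => integrable_fr (hv0 i)
  have hgB : (Measure.pi fun i => gaussianReal 0 (v i)).real B = ∫ z in B, g z ∂(gam d) := by
    rw [← hν, measureReal_def, withDensity_apply _ hB,
      integral_eq_lintegral_of_nonneg_ae (ae_of_all _ hg0) hgm.aestronglyMeasurable]
  have hg2 : ∫ z, g z ^ 2 ∂(gam d) = ∏ i, (Real.sqrt (1 - m i ^ 2))⁻¹ := by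
    simp only [hg, ← Finset.prod_pow]
    rw [gam, integral_fintype_prod_eq_prod (f := fun i x => fr (v i) x ^ 2)]
    exact Finset.prod_congr rfl fun i _ => integral_fr_sq _ (hm i) _ (hv i)
  have hgL : MemLp g 2 (gam d) := by
    rw [memLp_two_iff_integrable_sq hgm.aestronglyMeasurable]
    apply Integrable.of_integral_ne_zero
    rw [hg2]
    refine (Finset.prod_pos fun i _ => inv_pos.2 (Real.sqrt_pos.2 ?_)).ne'
    have := hle i; linarith
  have hg1 : ∫ z, g z ∂(gam d) = 1 := by
    have := hintg (fun _ => 1); simpa using this.symm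
  have hgq : ∫ z, g z * qd m z ∂(gam d) = s / 2 := by
    rw [← hintg, (integral_qd v m).2, hsd, Finset.sum_div]
    refine Finset.sum_congr rfl fun i _ => ?_
    rw [hv]; ring
  have hqL := memLp_qd m
  have hqi : Integrable (qd m) (gam d) := hqL.integrable (by norm_num)
  have hrL : MemLp (fun z => g z - 1 - qd m z) 2 (gam d) := (hgL.sub (memLp_const 1)).sub hqL
  have key : ∫ z, (g z - 1 - qd m z) ^ 2 ∂(gam d) ≤ 4 * s ^ 2 := by
    have e : ∀ z, (g z - 1 - qd m z) ^ 2
        = g z ^ 2 + 1 + qd m z ^ 2 - 2 * g z - 2 * (g z * qd m z) + 2 * qd m z := fun z => by ring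
    simp_rw [e]
    have i1 : Integrable (fun z => g z ^ 2) (gam d) := hgL.integrable_sq
    have i2 : Integrable (fun z => qd m z ^ 2) (gam d) := hqL.integrable_sq
    have i3 : Integrable (fun z => g z * qd m z) (gam d) := hgL.integrable_mul hqL
    have j1 : Integrable (fun z => g z ^ 2 + 1) (gam d) := i1.add (integrable_const 1)
    have j2 : Integrable (fun z => g z ^ 2 + 1 + qd m z ^ 2) (gam d) := j1.add i2
    have j3 : Integrable (fun z => g z ^ 2 + 1 + qd m z ^ 2 - 2 * g z) (gam d) :=
      j2.sub (hgi.const_mul 2)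
    have j4 : Integrable (fun z => g z ^ 2 + 1 + qd m z ^ 2 - 2 * g z - 2 * (g z * qd m z)) (gam d) :=
      j3.sub (i3.const_mul 2)
    rw [integral_add j4 (hqi.const_mul 2), integral_sub j3 (i3.const_mul 2),
      integral_sub j2 (hgi.const_mul 2), integral_add j1 i2, integral_add i1 (integrable_const 1),
      integral_const_mul, integral_const_mul, integral_const_mul, hg2, integral_qd_sq, hg1, hgq,
      integral_qd_gam]
    have := prod_bound m hs
    simp only [integral_const, probReal_univ, smul_eq_mul]
    rw [← hsd] at this ⊢
    linarith
  have e1 : (Measure.pi fun i => gaussianReal 0 (v i)).real B - (gam d).real B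
      - ∫ z in B, qd m z ∂(gam d) = ∫ z in B, (g z - 1 - qd m z) ∂(gam d) := by
    have k1 : IntegrableOn (fun z => g z - 1) B (gam d) := (hgi.sub (integrable_const 1)).integrableOn
    rw [integral_sub k1 hqi.integrableOn, integral_sub hgi.integrableOn (integrable_const 1), hgB]
    simp
  rw [e1]
  calc _ ≤ _ := l1_le_l2 _ _ hrL B
    _ ≤ Real.sqrt ((2 * s) ^ 2) := Real.sqrt_le_sqrt (by linarith)
    _ = _ := Real.sqrt_sq (by positivity)


/-- Characteristic function on `Fin d → ℝ`. -/
noncomputable def cf {d : ℕ} (μ : Measure (Fin d → ℝ)) (y : Fin d → ℝ) : ℂ :=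
  ∫ x, Complex.exp (Complex.I * ((y ⬝ᵥ x : ℝ) : ℂ)) ∂μ

/-- `ρ` has the characteristic function of `N(0,A)`. -/
def GaussCF {d : ℕ} (ρ : Measure (Fin d → ℝ)) (A : Matrix (Fin d) (Fin d) ℝ) : Prop :=
  ∀ y, cf ρ y = ((Real.exp (-(1/2) * (y ⬝ᵥ A.mulVec y)) : ℝ) : ℂ)

lemma cf_ext {d : ℕ} (μ ν : Measure (Fin d → ℝ)) [IsFiniteMeasure μ] [IsFiniteMeasure ν]
    (h : ∀ y, cf μ y = cf ν y) : μ = ν := by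
  apply Measure.ext_of_charFunDual
  ext L
  have hL : ∀ x : Fin d → ℝ, L x = (fun i => L (Pi.single i 1)) ⬝ᵥ x := by
    intro x
    have hx : x = ∑ i, x i • (Pi.single i (1:ℝ) : Fin d → ℝ) := by
      ext j; simp [Finset.sum_apply, Pi.single_apply]
    conv_lhs => rw [hx]
    rw [map_sum]
    simp only [dotProduct]
    refine Finset.sum_congr rfl fun i _ => ?_
    rw [map_smul, smul_eq_mul, mul_comm]
  have := h (fun i => L (Pi.single i 1))
  simp only [cf, ← hL] at this
  simpa only [charFunDual_apply, mul_comm] using this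

lemma GaussCF.ext {d : ℕ} {μ ν : Measure (Fin d → ℝ)} [IsFiniteMeasure μ] [IsFiniteMeasure ν]
    {A : Matrix (Fin d) (Fin d) ℝ} (h : GaussCF μ A) (h' : GaussCF ν A) : μ = ν :=
  cf_ext _ _ fun y => (h y).trans (h' y).symm

lemma meas_mulVec {d : ℕ} (T : Matrix (Fin d) (Fin d) ℝ) : Measurable (fun x => T.mulVec x) :=
  (Continuous.matrix_mulVec continuous_const continuous_id).measurable

lemma GaussCF.map {d : ℕ} {μ : Measure (Fin d → ℝ)} {A : Matrix (Fin d) (Fin d) ℝ}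
    (h : GaussCF μ A) (T : Matrix (Fin d) (Fin d) ℝ) :
    GaussCF (μ.map (fun x => T.mulVec x)) (T * A * Tᵀ) := by
  intro y
  have := h (Tᵀ.mulVec y)
  unfold cf at this ⊢
  rw [integral_map (meas_mulVec T).aemeasurable]
  · have e1 : ∀ x, y ⬝ᵥ T.mulVec x = Tᵀ.mulVec y ⬝ᵥ x := fun x => by
      rw [dotProduct_mulVec, mulVec_transpose]
    have e2 : y ⬝ᵥ (T * A * Tᵀ).mulVec y = Tᵀ.mulVec y ⬝ᵥ A.mulVec (Tᵀ.mulVec y) := by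
      rw [← mulVec_mulVec, ← mulVec_mulVec, e1]
    rw [e2, ← this]
    simp only [e1]
  · apply Measurable.aestronglyMeasurable
    have : Continuous fun x : Fin d → ℝ => y ⬝ᵥ x := Continuous.dotProduct continuous_const continuous_id
    fun_prop

lemma gaussCF_pi {d : ℕ} (v : Fin d → ℝ≥0) :
    GaussCF (Measure.pi fun i => gaussianReal 0 (v i)) (diagonal fun i => (v i : ℝ)) := by
  intro y
  unfold cf
  have e : ∀ x : Fin d → ℝ, Complex.exp (Complex.I * ((y ⬝ᵥ x : ℝ) : ℂ))
      = ∏ i, Complex.exp (y i * x i * Complex.I) := by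
    intro x
    rw [← Complex.exp_sum, ← Finset.sum_mul, mul_comm]
    simp [dotProduct]
  simp_rw [e]
  rw [integral_fintype_prod_eq_prod (f := fun i (x : ℝ) => Complex.exp (y i * x * Complex.I))]
  have e2 : ∀ i, ∫ x : ℝ, Complex.exp (y i * x * Complex.I) ∂(gaussianReal 0 (v i))
      = Complex.exp (-(v i * y i ^ 2 / 2)) := by
    intro i
    have := charFun_gaussianReal (μ := 0) (v := v i) (y i)
    rw [charFun_apply_real] at this
    rw [this]; congr 1; simp
  simp_rw [e2]
  rw [← Complex.exp_sum, Complex.ofReal_exp]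
  congr 1
  simp only [dotProduct, mulVec_diagonal]
  push_cast
  rw [Finset.mul_sum]
  refine Finset.sum_congr rfl fun i _ => ?_
  ring

lemma gaussCF_gam (d : ℕ) : GaussCF (gam d) 1 := by
  have := gaussCF_pi (fun _ : Fin d => 1)
  simpa [gam] using this

lemma hsNorm_sq {d : ℕ} (M : Matrix (Fin d) (Fin d) ℝ) : hsNorm M ^ 2 = ∑ i, ∑ j, M i j ^ 2 :=
  Real.sq_sqrt (Finset.sum_nonneg fun i _ => Finset.sum_nonneg fun j _ => sq_nonneg _)

lemma hsNorm_nonneg {d : ℕ} (M : Matrix (Fin d) (Fin d) ℝ) : 0 ≤ hsNorm M := Real.sqrt_nonneg _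

lemma hsNorm_sq_trace {d : ℕ} (M : Matrix (Fin d) (Fin d) ℝ) : hsNorm M ^ 2 = (M * Mᵀ).trace := by
  rw [hsNorm_sq]
  simp [Matrix.trace, Matrix.mul_apply, sq]

lemma spectral {d : ℕ} {N : Matrix (Fin d) (Fin d) ℝ} (hN : N.IsHermitian) :
    ∃ U : Matrix (Fin d) (Fin d) ℝ, Uᵀ * U = 1 ∧ U * Uᵀ = 1 ∧
      N = U * diagonal hN.eigenvalues * Uᵀ := by
  refine ⟨hN.eigenvectorUnitary, ?_, ?_, ?_⟩
  · exact Unitary.coe_star_mul_self hN.eigenvectorUnitary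
  · exact Unitary.coe_mul_star_self hN.eigenvectorUnitary
  · have := hN.spectral_theorem
    rw [Unitary.conjStarAlgAut_apply] at this
    exact this

/-- Quadratic form. -/
noncomputable def qf {d : ℕ} (N : Matrix (Fin d) (Fin d) ℝ) (z : Fin d → ℝ) : ℝ :=
  (z ⬝ᵥ N.mulVec z - N.trace) / 2

lemma qf_meas {d : ℕ} (N : Matrix (Fin d) (Fin d) ℝ) : Measurable (qf N) := by
  have : Continuous (qf N) := by
    unfold qf
    have : Continuous fun z : Fin d → ℝ => z ⬝ᵥ N.mulVec z :=
      Continuous.dotProduct continuous_id (Continuous.matrix_mulVec continuous_const continuous_id)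
    fun_prop
  exact this.measurable

lemma rot {d : ℕ} {N U : Matrix (Fin d) (Fin d) ℝ} {m : Fin d → ℝ} (h1 : Uᵀ * U = 1)
    (h2 : U * Uᵀ = 1) (hN : N = U * diagonal m * Uᵀ) :
    hsNorm N ^ 2 = ∑ i, m i ^ 2 ∧ (gam d).map (fun x => U.mulVec x) = gam d ∧
    ∀ B, MeasurableSet B → ∫ z in B, qf N z ∂(gam d)
      = ∫ z in (fun x => U.mulVec x) ⁻¹' B, qd m z ∂(gam d) := by
  have hg : (gam d).map (fun x => U.mulVec x) = gam d := by
    have : IsProbabilityMeasure ((gam d).map (fun x => U.mulVec x)) :=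
      Measure.isProbabilityMeasure_map (meas_mulVec U).aemeasurable
    have := (gaussCF_gam d).map U
    rw [mul_one, h2] at this
    exact this.ext (gaussCF_gam d)
  have hq : ∀ w, qf N (U.mulVec w) = qd m w := by
    intro w
    have ht : N.trace = ∑ i, m i := by
      rw [hN, Matrix.trace_mul_comm, ← Matrix.mul_assoc, h1, Matrix.one_mul, Matrix.trace_diagonal]
    have : (U.mulVec w) ⬝ᵥ N.mulVec (U.mulVec w) = ∑ i, m i * w i ^ 2 := by
      rw [hN, mulVec_mulVec, Matrix.mul_assoc, h1, Matrix.mul_one, ← mulVec_mulVec,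
        dotProduct_mulVec, ← mulVec_transpose, mulVec_mulVec, h1, one_mulVec]
      simp only [dotProduct, mulVec_diagonal]
      exact Finset.sum_congr rfl fun i _ => by ring
    unfold qf qd
    rw [this, ht, ← Finset.sum_sub_distrib, Finset.sum_div]
    exact Finset.sum_congr rfl fun i _ => by ring
  refine ⟨?_, hg, fun B hB => ?_⟩
  · have e : N * Nᵀ = U * (diagonal m * diagonal m * Uᵀ) := by
      calc N * Nᵀ = U * diagonal m * (Uᵀ * U) * diagonal m * Uᵀ := by
            rw [hN]; simp [Matrix.transpose_mul, Matrix.mul_assoc]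
        _ = _ := by rw [h1]; simp only [Matrix.mul_one, Matrix.mul_assoc]
    rw [hsNorm_sq_trace, e, Matrix.trace_mul_comm, Matrix.mul_assoc, h1, Matrix.mul_one,
      Matrix.diagonal_mul_diagonal, Matrix.trace_diagonal]
    exact Finset.sum_congr rfl fun i _ => by ring
  · conv_lhs => rw [← hg]
    rw [setIntegral_map hB (qf_meas N).aestronglyMeasurable (meas_mulVec U).aemeasurable]
    simp only [hq]

lemma lin_bound {d : ℕ} {N : Matrix (Fin d) (Fin d) ℝ} (hN : N.IsHermitian)
    (B : Set (Fin d → ℝ)) (hB : MeasurableSet B) :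
    |∫ z in B, qf N z ∂(gam d)| ≤ hsNorm N / Real.sqrt 2 := by
  obtain ⟨U, h1, h2, h3⟩ := spectral hN
  obtain ⟨r1, r2, r3⟩ := rot h1 h2 h3
  rw [r3 B hB]
  refine (diag_q _ _).trans_eq ?_
  rw [← r1, Real.sqrt_div (sq_nonneg _), Real.sqrt_sq (hsNorm_nonneg _)]

lemma core {d : ℕ} {N : Matrix (Fin d) (Fin d) ℝ} (hN : N.IsHermitian) (ρ : Measure (Fin d → ℝ))
    [IsProbabilityMeasure ρ] (hρ : GaussCF ρ (1 + N)) (B : Set (Fin d → ℝ)) (hB : MeasurableSet B) :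
    |ρ.real B - (gam d).real B - ∫ z in B, qf N z ∂(gam d)| ≤ 6 * hsNorm N ^ 2 := by
  have hn0 := hsNorm_nonneg N
  by_cases hbig : 1 / 2 < hsNorm N
  · have h1 := lin_bound hN B hB
    have h2 : hsNorm N / Real.sqrt 2 ≤ hsNorm N :=
      div_le_self hn0 (Real.one_le_sqrt.2 (by norm_num))
    have a1 : ρ.real B ≤ 1 := measureReal_le_one
    have a2 : (gam d).real B ≤ 1 := measureReal_le_one
    have a3 : 0 ≤ ρ.real B := measureReal_nonneg
    have a4 : 0 ≤ (gam d).real B := measureReal_nonneg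
    have h3 := abs_le.1 (h1.trans h2)
    rw [abs_le]
    constructor <;> nlinarith
  · push Not at hbig
    obtain ⟨U, h1, h2, h3⟩ := spectral hN
    obtain ⟨r1, r2, r3⟩ := rot h1 h2 h3
    set m := hN.eigenvalues
    have hs : ∑ i, m i ^ 2 ≤ 1 / 4 := by rw [← r1]; nlinarith
    have hm : ∀ i, 0 ≤ 1 + m i := fun i => by
      have : m i ^ 2 ≤ ∑ i, m i ^ 2 :=
        Finset.single_le_sum (f := fun i => m i ^ 2) (fun i _ => sq_nonneg _) (Finset.mem_univ i)
      nlinarith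
    let v : Fin d → ℝ≥0 := fun i => ⟨1 + m i, hm i⟩
    have hg := diag_good m hs v (fun i => rfl) _ (meas_mulVec U hB)
    have hρ' : ρ = (Measure.pi fun i => gaussianReal 0 (v i)).map (fun x => U.mulVec x) := by
      have : IsProbabilityMeasure ((Measure.pi fun i => gaussianReal 0 (v i)).map
        (fun x => U.mulVec x)) := Measure.isProbabilityMeasure_map (meas_mulVec U).aemeasurable
      refine hρ.ext ?_
      have := (gaussCF_pi v).map U
      have e : (diagonal fun i => (v i : ℝ)) = 1 + diagonal m := by
        rw [← diagonal_one, diagonal_add]; rfl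
      rwa [e, Matrix.mul_add, Matrix.add_mul, Matrix.mul_one, h2, ← h3] at this
    rw [r3 B hB, hρ', map_measureReal_apply (meas_mulVec U) hB]
    have : (gam d).real B = (gam d).real ((fun x => U.mulVec x) ⁻¹' B) := by
      conv_lhs => rw [← r2]
      rw [map_measureReal_apply (meas_mulVec U) hB]
    rw [this]
    refine hg.trans ?_
    rw [r1]
    have : 0 ≤ ∑ i, m i ^ 2 := Finset.sum_nonneg fun i _ => sq_nonneg _
    linarith


lemma exists_sqrt {d : ℕ} {K : Matrix (Fin d) (Fin d) ℝ} (hK : K.PosDef) :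
    ∃ S T : Matrix (Fin d) (Fin d) ℝ, Sᵀ = S ∧ Tᵀ = T ∧ S * S = K ∧ S * T = 1 ∧ T * S = 1 ∧
      K⁻¹ = T * T := by
  obtain ⟨U, h1, h2, h3⟩ := spectral hK.1
  have hp : ∀ i, 0 < hK.1.eigenvalues i := hK.eigenvalues_pos
  set m := hK.1.eigenvalues
  set D := diagonal (fun i => Real.sqrt (m i)) with hD
  set E := diagonal (fun i => (Real.sqrt (m i))⁻¹) with hE
  have hs : ∀ i, Real.sqrt (m i) ≠ 0 := fun i => (Real.sqrt_pos.2 (hp i)).ne'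
  have key : ∀ X Y : Matrix (Fin d) (Fin d) ℝ, (U * X * Uᵀ) * (U * Y * Uᵀ) = U * (X * Y) * Uᵀ := by
    intro X Y
    calc _ = U * X * (Uᵀ * U) * Y * Uᵀ := by simp only [Matrix.mul_assoc]
      _ = _ := by rw [h1]; simp only [Matrix.mul_one, Matrix.mul_assoc]
  have hDE : D * E = 1 := by
    rw [hD, hE, diagonal_mul_diagonal, ← diagonal_one]; congr 1; ext i; exact mul_inv_cancel₀ (hs i)
  have hED : E * D = 1 := by
    rw [hD, hE, diagonal_mul_diagonal, ← diagonal_one]; congr 1; ext i; exact inv_mul_cancel₀ (hs i)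
  have hDD : D * D = diagonal m := by
    rw [hD, diagonal_mul_diagonal]; congr 1; ext i; exact Real.mul_self_sqrt (hp i).le
  have c1 : (U * D * Uᵀ) * (U * D * Uᵀ) = K := by rw [key, hDD, ← h3]
  have c2 : (U * D * Uᵀ) * (U * E * Uᵀ) = 1 := by rw [key, hDE, Matrix.mul_one, h2]
  have c3 : (U * E * Uᵀ) * (U * D * Uᵀ) = 1 := by rw [key, hED, Matrix.mul_one, h2]
  refine ⟨U * D * Uᵀ, U * E * Uᵀ, ?_, ?_, c1, c2, c3, ?_⟩
  · simp [hD, Matrix.transpose_mul, Matrix.mul_assoc]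
  · simp [hE, Matrix.transpose_mul, Matrix.mul_assoc]
  · apply Matrix.inv_eq_right_inv
    set S := U * D * Uᵀ
    set T := U * E * Uᵀ
    rw [← c1]
    calc S * S * (T * T) = S * (S * T) * T := by simp only [Matrix.mul_assoc]
      _ = 1 := by rw [c2, Matrix.mul_one, c2]

lemma gam_density (d : ℕ) : gam d = volume.withDensity
    (fun x : Fin d → ℝ => ENNReal.ofReal (∏ i, gaussianPDFReal 0 1 (x i))) := by
  rw [volume_pi]
  symm
  refine pi_withDensity_real _ (fun _ => gaussianPDFReal 0 1) (fun _ => gaussianPDFReal_nonneg _ _)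
    (fun _ => integrable_gaussianPDFReal _ _) _ (fun _ => ?_)
  rw [gaussianReal_of_var_ne_zero _ one_ne_zero]; rfl

lemma gaussDensity_meas {d : ℕ} (M : Matrix (Fin d) (Fin d) ℝ) : Measurable (gaussDensity M) := by
  have : Continuous (gaussDensity M) := by
    unfold gaussDensity
    have : Continuous fun z : Fin d → ℝ => z ⬝ᵥ M⁻¹.mulVec z :=
      Continuous.dotProduct continuous_id (Continuous.matrix_mulVec continuous_const continuous_id)
    fun_prop
  exact this.measurable

lemma gaussLaw_eq {d : ℕ} {K S T : Matrix (Fin d) (Fin d) ℝ} (hS : Sᵀ = S) (hT : Tᵀ = T)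
    (h1 : S * S = K) (h2 : S * T = 1) (h3 : T * S = 1) (h4 : K⁻¹ = T * T) :
    gaussLaw K = (gam d).map (fun x => S.mulVec x) := by
  have hdet : S.det ≠ 0 := by
    intro h
    have := congrArg Matrix.det h2
    rw [det_mul, h, zero_mul, det_one] at this
    exact zero_ne_one this
  have hvol := Real.map_matrix_volume_pi_eq_smul_volume_pi hdet
  have hfun : (⇑(toLin' S) : (Fin d → ℝ) → Fin d → ℝ) = fun x => S.mulVec x := by
    ext x; simp
  rw [hfun] at hvol
  have hvol2 : (volume : Measure (Fin d → ℝ)) =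
      ENNReal.ofReal |S.det| • (volume : Measure (Fin d → ℝ)).map (fun x => S.mulVec x) := by
    rw [hvol, smul_smul, ← ENNReal.ofReal_mul (abs_nonneg _), ← abs_mul, mul_inv_cancel₀ hdet]
    simp
  ext B hB
  rw [Measure.map_apply (meas_mulVec S) hB, gam_density, gaussLaw, withDensity_apply _ hB,
    withDensity_apply _ (meas_mulVec S hB)]
  have hm : Measurable fun z => ENNReal.ofReal (gaussDensity K (S.mulVec z)) :=
    ((gaussDensity_meas K).comp (meas_mulVec S)).ennreal_ofReal
  conv_lhs => rw [hvol2]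
  rw [Measure.restrict_smul, lintegral_smul_measure, setLIntegral_map hB
    (gaussDensity_meas K).ennreal_ofReal (meas_mulVec S), smul_eq_mul,
    ← lintegral_const_mul _ hm]
  congr 1
  ext z
  rw [← ENNReal.ofReal_mul (abs_nonneg _)]
  congr 1
  have hq : S.mulVec z ⬝ᵥ K⁻¹.mulVec (S.mulVec z) = ∑ i, z i ^ 2 := by
    rw [h4, mulVec_mulVec, Matrix.mul_assoc, h3, Matrix.mul_one, dotProduct_mulVec,
      ← mulVec_transpose, hT, mulVec_mulVec, h3, one_mulVec]
    simp [dotProduct, sq]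
  have hd2 : Real.sqrt ((2 * Real.pi) ^ d * K.det) = Real.sqrt (2 * Real.pi) ^ d * |S.det| := by
    rw [← h1, det_mul, Real.sqrt_mul (by positivity), Real.sqrt_mul_self_eq_abs]
    congr 1
    rw [Real.sqrt_eq_iff_mul_self_eq (by positivity) (by positivity), ← mul_pow,
      Real.mul_self_sqrt (by positivity)]
  unfold gaussDensity
  rw [hq, hd2]
  simp only [gaussianPDFReal, NNReal.coe_one, sub_zero, mul_one]
  rw [Finset.prod_mul_distrib, ← Real.exp_sum]
  have : |S.det| ≠ 0 := abs_ne_zero.2 hdet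
  have e : ∑ i, -z i ^ 2 / 2 = -(1/2) * ∑ i, z i ^ 2 := by
    rw [Finset.mul_sum]; exact Finset.sum_congr rfl fun i _ => by ring
  rw [e]
  simp only [Finset.prod_const, Finset.card_univ, Fintype.card_fin, inv_pow]
  have : Real.sqrt (2 * Real.pi) ^ d ≠ 0 := by positivity
  field_simp

lemma dot_nonneg {d : ℕ} (x : Fin d → ℝ) : 0 ≤ x ⬝ᵥ x :=
  Finset.sum_nonneg fun i _ => mul_self_nonneg _

lemma hsNorm_transpose {d : ℕ} (M : Matrix (Fin d) (Fin d) ℝ) : hsNorm Mᵀ = hsNorm M := by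
  unfold hsNorm; rw [Finset.sum_comm]; rfl

lemma hs_mul_left {d : ℕ} {T : Matrix (Fin d) (Fin d) ℝ} {c : ℝ}
    (hc : ∀ h, T.mulVec h ⬝ᵥ T.mulVec h ≤ c * (h ⬝ᵥ h)) (M : Matrix (Fin d) (Fin d) ℝ) :
    hsNorm (T * M) ^ 2 ≤ c * hsNorm M ^ 2 := by
  rw [hsNorm_sq, hsNorm_sq, Finset.sum_comm, Finset.sum_comm (f := fun i j => M i j ^ 2),
    Finset.mul_sum]
  refine Finset.sum_le_sum fun j _ => ?_
  have := hc (fun i => M i j)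
  simpa only [dotProduct, mulVec, ← sq, Matrix.mul_apply] using this

lemma hs_conj {d : ℕ} {T : Matrix (Fin d) (Fin d) ℝ} (hT : Tᵀ = T) {c : ℝ} (hc0 : 0 ≤ c)
    (hc : ∀ h, T.mulVec h ⬝ᵥ T.mulVec h ≤ c * (h ⬝ᵥ h)) (H : Matrix (Fin d) (Fin d) ℝ) :
    hsNorm (T * H * T) ≤ c * hsNorm H := by
  refine le_of_sq_le_sq ?_ (mul_nonneg hc0 (hsNorm_nonneg _))
  have h1 := hs_mul_left hc (H * T)
  have h2 := hs_mul_left hc Hᵀ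
  have e : hsNorm (H * T) = hsNorm (T * Hᵀ) := by
    rw [← hsNorm_transpose, Matrix.transpose_mul, hT]
  rw [Matrix.mul_assoc]
  rw [hsNorm_transpose, ← e] at h2
  calc _ ≤ _ := h1
    _ ≤ c * (c * hsNorm H ^ 2) := by gcongr
    _ = _ := by ring

lemma quad_le {d : ℕ} (M : Matrix (Fin d) (Fin d) ℝ) (h : Fin d → ℝ) :
    h ⬝ᵥ M.mulVec h ≤ hsNorm M * (h ⬝ᵥ h) := by
  have h1 : (h ⬝ᵥ M.mulVec h) ^ 2 ≤ (h ⬝ᵥ h) * (M.mulVec h ⬝ᵥ M.mulVec h) := by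
    have := Finset.sum_mul_sq_le_sq_mul_sq Finset.univ h (M.mulVec h)
    simpa only [dotProduct, ← sq] using this
  have h2 : M.mulVec h ⬝ᵥ M.mulVec h ≤ hsNorm M ^ 2 * (h ⬝ᵥ h) := by
    rw [hsNorm_sq, Finset.sum_mul]
    refine Finset.sum_le_sum fun i _ => ?_
    have := Finset.sum_mul_sq_le_sq_mul_sq Finset.univ (M i) h
    simpa only [dotProduct, mulVec, ← sq] using this
  have h0 := dot_nonneg h
  refine le_of_sq_le_sq ?_ (mul_nonneg (hsNorm_nonneg _) h0)
  calc _ ≤ _ := h1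
    _ ≤ (h ⬝ᵥ h) * (hsNorm M ^ 2 * (h ⬝ᵥ h)) := by gcongr
    _ = _ := by ring

lemma euclNorm_one {d : ℕ} (x : Fin d → ℝ) : euclNorm x = 1 ↔ x ⬝ᵥ x = 1 := by
  unfold euclNorm
  rw [Real.sqrt_eq_one]
  simp [dotProduct, sq]

lemma mulVec_dot_self {d : ℕ} {S : Matrix (Fin d) (Fin d) ℝ} (hS : Sᵀ = S) (x : Fin d → ℝ) :
    S.mulVec x ⬝ᵥ S.mulVec x = x ⬝ᵥ (S * S).mulVec x := by
  rw [← mulVec_mulVec, dotProduct_mulVec x, ← mulVec_transpose, hS]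

lemma T_bounds {d : ℕ} (hd : 1 ≤ d) {K S T : Matrix (Fin d) (Fin d) ℝ} (hS : Sᵀ = S) (hT : Tᵀ = T)
    (h1 : S * S = K) (h2 : S * T = 1) (h3 : T * S = 1) (h4 : K⁻¹ = T * T) :
    0 < lambdaMin K ∧
    (∀ h, T.mulVec h ⬝ᵥ T.mulVec h ≤ hsNorm K⁻¹ * (h ⬝ᵥ h)) ∧
    (∀ h, T.mulVec h ⬝ᵥ T.mulVec h ≤ (lambdaMin K)⁻¹ * (h ⬝ᵥ h)) := by
  have hb1 : ∀ h, T.mulVec h ⬝ᵥ T.mulVec h ≤ hsNorm K⁻¹ * (h ⬝ᵥ h) := fun h => by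
    rw [mulVec_dot_self hT, ← h4]; exact quad_le _ _
  have hTS : ∀ x, T.mulVec (S.mulVec x) = x := fun x => by rw [mulVec_mulVec, h3, one_mulVec]
  have hST : ∀ x, S.mulVec (T.mulVec x) = x := fun x => by rw [mulVec_mulVec, h2, one_mulVec]
  have hR : ∀ x, x ⬝ᵥ K.mulVec x = S.mulVec x ⬝ᵥ S.mulVec x := fun x => by
    rw [mulVec_dot_self hS, h1]
  set R := {r : ℝ | ∃ x : Fin d → ℝ, euclNorm x = 1 ∧ r = x ⬝ᵥ K.mulVec x} with hRd
  have hbdd : BddBelow R := ⟨0, by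
    rintro r ⟨x, _, rfl⟩; rw [hR]; exact dot_nonneg _⟩
  have hlow : ∀ x : Fin d → ℝ, x ⬝ᵥ x = 1 → 1 ≤ hsNorm K⁻¹ * (x ⬝ᵥ K.mulVec x) := by
    intro x hx
    have := hb1 (S.mulVec x)
    rwa [hTS, hx, ← hR] at this
  have hx0 : (Pi.single (⟨0, hd⟩ : Fin d) (1:ℝ)) ⬝ᵥ (Pi.single (⟨0, hd⟩ : Fin d) (1:ℝ)) = 1 := by simp
  have hpos : 0 < hsNorm K⁻¹ := by
    rcases (hsNorm_nonneg K⁻¹).lt_or_eq with h | h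
    · exact h
    · have := hlow _ hx0
      rw [← h, zero_mul] at this; linarith
  have hlam : 0 < lambdaMin K := by
    have : (hsNorm K⁻¹)⁻¹ ≤ lambdaMin K := by
      apply le_csInf
      · exact ⟨_, _, (euclNorm_one _).2 hx0, rfl⟩
      · rintro r ⟨x, hx, rfl⟩
        rw [inv_le_iff_one_le_mul₀ hpos, mul_comm]
        exact hlow x ((euclNorm_one _).1 hx)
    exact (inv_pos.2 hpos).trans_le this
  refine ⟨hlam, hb1, fun h => ?_⟩
  set w := T.mulVec h with hw
  have hSw : S.mulVec w = h := hST h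
  rw [le_inv_mul_iff₀ hlam]
  rcases (dot_nonneg w).lt_or_eq with hp | h0
  · set a := Real.sqrt (w ⬝ᵥ w) with ha
    have ha0 : 0 < a := Real.sqrt_pos.2 hp
    have ha2 : a * a = w ⬝ᵥ w := Real.mul_self_sqrt hp.le
    have hu : (a⁻¹ • w) ⬝ᵥ (a⁻¹ • w) = 1 := by
      rw [smul_dotProduct, dotProduct_smul, ← ha2, smul_eq_mul, smul_eq_mul]; field_simp
    have : lambdaMin K ≤ (a⁻¹ • w) ⬝ᵥ K.mulVec (a⁻¹ • w) :=
      csInf_le hbdd ⟨_, (euclNorm_one _).2 hu, rfl⟩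
    rw [mulVec_smul, smul_dotProduct, dotProduct_smul, hR, hSw, smul_eq_mul, smul_eq_mul,
      ← mul_assoc, ← mul_inv, ha2, inv_mul_eq_div, le_div_iff₀ hp] at this
    exact this
  · rw [← h0, mul_zero]; exact dot_nonneg _


lemma cf_continuous {d : ℕ} (μ : Measure (Fin d → ℝ)) [IsProbabilityMeasure μ] :
    Continuous (cf μ) := by
  unfold cf
  refine continuous_of_dominated (bound := fun _ => 1) (fun y => ?_) (fun y => ?_)
    (integrable_const _) ?_
  · refine Continuous.aestronglyMeasurable ?_
    unfold dotProduct; fun_prop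
  · refine ae_of_all _ fun x => ?_
    rw [mul_comm, Complex.norm_exp_ofReal_mul_I]
  · refine ae_of_all _ fun x => ?_
    unfold dotProduct; fun_prop

lemma cond_law {d : ℕ} {Ω : Type*} [mΩ : MeasurableSpace Ω] (P : Measure Ω)
    [IsProbabilityMeasure P] (F : Ω → Fin d → ℝ) (m : {m : MeasurableSpace Ω // m ≤ mΩ})
    (A : Ω → Matrix (Fin d) (Fin d) ℝ) (h : CondGaussian P F m.1 A) :
    ∃ ρ : Ω → Measure (Fin d → ℝ), (∀ ω, IsProbabilityMeasure (ρ ω)) ∧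
      (∀ᵐ ω ∂P, GaussCF (ρ ω) (A ω)) ∧
      (∀ B, MeasurableSet B → Integrable (fun ω => (ρ ω).real B) P ∧
        (P.map F).real B = ∫ ω, (ρ ω).real B ∂P) := by
  obtain ⟨hF, -, -, hA, hc⟩ := h
  set X : Ω → Fin d → Fin d → ℝ := fun ω i j => A ω i j with hX
  have hFm : AEMeasurable F P := hF.1.aemeasurable
  have hXm : Measurable X := hA.mono m.2 le_rfl
  have hle : MeasurableSpace.comap X inferInstance ≤ m.1 := hA.comap_le
  refine ⟨fun ω => condDistrib F X P (X ω), fun ω => inferInstance, ?_, fun B hB => ⟨?_, ?_⟩⟩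
  · have key : ∀ y : Fin d → ℝ, ∀ᵐ ω ∂P, cf (condDistrib F X P (X ω)) y =
        ((Real.exp (-(1/2)*(y ⬝ᵥ (A ω).mulVec y)):ℝ):ℂ) := by
      intro y
      have hcont : Continuous fun x : Fin d → ℝ => Complex.exp (Complex.I * ((y ⬝ᵥ x : ℝ) : ℂ)) := by
        unfold dotProduct; fun_prop
      have hintg : Integrable (fun ω => Complex.exp (Complex.I * ((y ⬝ᵥ F ω : ℝ) : ℂ))) P := by
        refine Integrable.of_bound (C := 1)
          (hcont.measurable.comp_aemeasurable hFm).aestronglyMeasurable (ae_of_all _ fun ω => ?_)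
        rw [mul_comm, Complex.norm_exp_ofReal_mul_I]
      have e1 := condExp_ae_eq_integral_condDistrib (μ := P) hXm hFm hcont.stronglyMeasurable hintg
      have e2 := condExp_condExp_of_le (μ := P)
        (f := fun ω => Complex.exp (Complex.I * ((y ⬝ᵥ F ω : ℝ) : ℂ))) hle m.2
      have e3 := condExp_congr_ae (m := MeasurableSpace.comap X inferInstance) (hc y)
      have hg : Measurable fun a : Fin d → Fin d → ℝ =>
          ((Real.exp (-(1/2)*(y ⬝ᵥ (Matrix.mulVec a y))):ℝ):ℂ) := by
        refine Continuous.measurable ?_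
        unfold mulVec dotProduct; fun_prop
      have hs : StronglyMeasurable[MeasurableSpace.comap X inferInstance] fun ω =>
          ((Real.exp (-(1/2)*(y ⬝ᵥ (A ω).mulVec y)):ℝ):ℂ) :=
        (hg.comp (comap_measurable X)).stronglyMeasurable
      have hi2 : Integrable (fun ω => ((Real.exp (-(1/2)*(y ⬝ᵥ (A ω).mulVec y)):ℝ):ℂ)) P :=
        integrable_condExp.congr (hc y)
      have e4 := condExp_of_stronglyMeasurable (hle.trans m.2) hs hi2
      rw [e4] at e3
      filter_upwards [e1, e2, e3] with ω h1 h2 h3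
      unfold cf
      rw [← h1, ← h2, h3]
    obtain ⟨D, hDc, hDd⟩ := TopologicalSpace.exists_countable_dense (Fin d → ℝ)
    have := (ae_ball_iff hDc).2 fun y (_ : y ∈ D) => key y
    filter_upwards [this] with ω hω y
    have hc1 : Continuous (cf (condDistrib F X P (X ω))) := cf_continuous _
    have hc2 : Continuous fun y => ((Real.exp (-(1/2)*(y ⬝ᵥ (A ω).mulVec y)):ℝ):ℂ) := by
      unfold mulVec dotProduct; fun_prop
    exact congrFun (hc1.ext_on hDd hc2 fun y hy => hω y hy) y
  · exact integrable_toReal_condDistrib hXm.aemeasurable hB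
  · have hk : Measurable fun a => condDistrib F X P a B := Kernel.measurable_coe _ hB
    unfold Measure.real
    have hkX : Measurable fun ω => condDistrib F X P (X ω) B := hk.comp hXm
    beta_reduce
    rw [integral_toReal hkX.aemeasurable (ae_of_all _ fun _ => measure_lt_top _ _)]
    rw [← condDistrib_comp_map hXm.aemeasurable hFm, Measure.bind_apply hB (Kernel.aemeasurable _),
      lintegral_map hk hXm]

lemma integrable_zz {d : ℕ} (i j : Fin d) :
    Integrable (fun z : Fin d → ℝ => z i * z j) (gam d) := by
  have h : MemLp (fun z : ℝ => z) 2 (gaussianReal 0 1) := by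
    rw [memLp_two_iff_integrable_sq (by fun_prop)]; exact integrable_pow_gauss 1 2
  exact (memLp_comp_eval i h).integrable_mul (memLp_comp_eval j h)

noncomputable def cc {d : ℕ} (B : Set (Fin d → ℝ)) (i j : Fin d) : ℝ :=
  ∫ z in B, (z i * z j - (if i = j then 1 else 0)) / 2 ∂gam d

lemma lin_repr {d : ℕ} (N : Matrix (Fin d) (Fin d) ℝ) (B : Set (Fin d → ℝ)) :
    ∫ z in B, qf N z ∂gam d = ∑ i, ∑ j, N i j * cc B i j := by
  have e : ∀ z, qf N z = ∑ i, ∑ j, N i j * ((z i * z j - (if i = j then 1 else 0)) / 2) := by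
    intro z
    simp only [qf, dotProduct, mulVec, trace, diag, Finset.mul_sum, mul_div_assoc', mul_sub,
      sub_div, Finset.sum_sub_distrib, Finset.sum_div]
    congr 1
    · exact Finset.sum_congr rfl fun i _ => Finset.sum_congr rfl fun j _ => by ring
    · exact Finset.sum_congr rfl fun i _ => by simp [← Finset.sum_div]
  have hi : ∀ i j : Fin d, Integrable (fun z : Fin d → ℝ =>
      N i j * ((z i * z j - (if i = j then 1 else 0)) / 2)) ((gam d).restrict B) := fun i j =>
    ((((integrable_zz i j).sub (integrable_const _)).div_const 2).const_mul _).restrict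
  simp_rw [e]
  rw [integral_finsetSum _ fun i _ => integrable_finsetSum _ fun j _ => hi i j]
  refine Finset.sum_congr rfl fun i _ => ?_
  rw [integral_finsetSum _ fun j _ => hi i j]
  refine Finset.sum_congr rfl fun j _ => ?_
  rw [integral_const_mul]; rfl

lemma conj_apply {d : ℕ} (T H : Matrix (Fin d) (Fin d) ℝ) (i j : Fin d) :
    (T * H * T) i j = ∑ k, ∑ l, T i l * T k j * H l k := by
  simp only [Matrix.mul_apply, Finset.sum_mul]
  exact Finset.sum_congr rfl fun k _ => Finset.sum_congr rfl fun l _ => by ring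

lemma lin_expect {d : ℕ} {Ω : Type*} [MeasurableSpace Ω] (P : Measure Ω)
    [IsProbabilityMeasure P] (A : Ω → Matrix (Fin d) (Fin d) ℝ)
    (hA : ∀ i j, Integrable (fun ω => A ω i j) P) (K T : Matrix (Fin d) (Fin d) ℝ)
    (B : Set (Fin d → ℝ)) :
    Integrable (fun ω => ∫ z in B, qf (T * (A ω - K) * T) z ∂gam d) P ∧
    ∫ ω, (∫ z in B, qf (T * (A ω - K) * T) z ∂gam d) ∂P =
      ∫ z in B, qf (T * ((Matrix.of fun i j => ∫ ω, A ω i j ∂P) - K) * T) z ∂gam d := by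
  have h0 : ∀ l k, Integrable (fun ω => (A ω - K) l k) P := fun l k =>
    (hA l k).sub (integrable_const _)
  have h00 : ∀ l k, ∫ ω, (A ω - K) l k ∂P = ((Matrix.of fun i j => ∫ ω, A ω i j ∂P) - K) l k := by
    intro l k
    simp only [Matrix.sub_apply, Matrix.of_apply]
    rw [integral_sub (hA l k) (integrable_const _)]; simp
  have h1 : ∀ i j l k, Integrable (fun ω => T i l * T k j * (A ω - K) l k) P := fun i j l k =>
    (h0 l k).const_mul _
  have h2 : ∀ i j, Integrable (fun ω => (T * (A ω - K) * T) i j) P := by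
    intro i j
    simp_rw [conj_apply]
    exact integrable_finsetSum _ fun k _ => integrable_finsetSum _ fun l _ => h1 i j l k
  have h3 : ∀ i j, ∫ ω, (T * (A ω - K) * T) i j ∂P =
      (T * ((Matrix.of fun i j => ∫ ω, A ω i j ∂P) - K) * T) i j := by
    intro i j
    simp_rw [conj_apply]
    rw [integral_finsetSum _ fun k _ => integrable_finsetSum _ fun l _ => h1 i j l k]
    refine Finset.sum_congr rfl fun k _ => ?_
    rw [integral_finsetSum _ fun l _ => h1 i j l k]
    refine Finset.sum_congr rfl fun l _ => ?_
    rw [integral_const_mul, h00]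
  simp_rw [lin_repr]
  refine ⟨integrable_finsetSum _ fun i _ => integrable_finsetSum _ fun j _ =>
    (h2 i j).mul_const _, ?_⟩
  rw [integral_finsetSum _ fun i _ => integrable_finsetSum _ fun j _ => (h2 i j).mul_const _]
  refine Finset.sum_congr rfl fun i _ => ?_
  rw [integral_finsetSum _ fun j _ => (h2 i j).mul_const _]
  refine Finset.sum_congr rfl fun j _ => ?_
  rw [integral_mul_const, h3]

lemma sq_integral_le {Ω : Type*} [MeasurableSpace Ω] (P : Measure Ω)
    [IsProbabilityMeasure P] (f : Ω → ℝ) (hf : AEStronglyMeasurable f P)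
    (h2 : Integrable (fun ω => f ω ^ 2) P) : Integrable f P ∧ (∫ ω, f ω ∂P) ^ 2 ≤ ∫ ω, f ω ^ 2 ∂P := by
  have hm : MemLp f 2 P := (memLp_two_iff_integrable_sq hf).2 h2
  refine ⟨hm.integrable (by norm_num), ?_⟩
  have := l1_le_l2 P f hm Set.univ
  rw [setIntegral_univ] at this
  rw [← sq_abs]
  calc |∫ ω, f ω ∂P| ^ 2 ≤ Real.sqrt (∫ ω, f ω ^ 2 ∂P) ^ 2 := by gcongr
    _ = _ := Real.sq_sqrt (integral_nonneg fun _ => sq_nonneg _)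

lemma jensen {Ω : Type*} [MeasurableSpace Ω] (P : Measure Ω)
    [IsProbabilityMeasure P] (f : Ω → ℝ) (hf : AEStronglyMeasurable f P)
    (h8 : Integrable (fun ω => f ω ^ 8) P) : Integrable f P ∧ Integrable (fun ω => f ω ^ 2) P ∧
      ∫ ω, f ω ^ 2 ∂P ≤ (∫ ω, f ω ^ 8 ∂P) ^ ((1:ℝ)/4) := by
  have a := sq_integral_le P (fun ω => f ω ^ 4) (hf.pow 4) (by
    refine h8.congr (ae_of_all _ fun ω => ?_); simp only; ring)
  have b := sq_integral_le P (fun ω => f ω ^ 2) (hf.pow 2) (by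
    refine a.1.congr (ae_of_all _ fun ω => ?_); simp only; ring)
  have c := sq_integral_le P f hf b.1
  refine ⟨c.1, b.1, ?_⟩
  have e1 : ∫ ω, (f ω ^ 4) ^ 2 ∂P = ∫ ω, f ω ^ 8 ∂P := integral_congr_ae
    (ae_of_all _ fun ω => by simp only; ring)
  have e2 : ∫ ω, (f ω ^ 2) ^ 2 ∂P = ∫ ω, f ω ^ 4 ∂P := integral_congr_ae
    (ae_of_all _ fun ω => by simp only; ring)
  have n2 : 0 ≤ ∫ ω, f ω ^ 2 ∂P := integral_nonneg fun _ => sq_nonneg _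
  have h : (∫ ω, f ω ^ 2 ∂P) ^ 4 ≤ ∫ ω, f ω ^ 8 ∂P := by
    rw [← e1]
    refine le_trans ?_ a.2
    rw [← e2]
    calc (∫ ω, f ω ^ 2 ∂P) ^ 4 = ((∫ ω, f ω ^ 2 ∂P) ^ 2) ^ 2 := by ring
      _ ≤ _ := by gcongr; exact b.2
  calc ∫ ω, f ω ^ 2 ∂P = ((∫ ω, f ω ^ 2 ∂P) ^ 4) ^ ((1:ℝ)/4) := by
        rw [← Real.rpow_natCast, ← Real.rpow_mul n2]; norm_num
    _ ≤ _ := Real.rpow_le_rpow (by positivity) h (by norm_num)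

lemma hsNorm_meas {d : ℕ} {Ω : Type*} [MeasurableSpace Ω] {A : Ω → Matrix (Fin d) (Fin d) ℝ}
    (hA : ∀ i j, Measurable fun ω => A ω i j) : Measurable fun ω => hsNorm (A ω) := by
  unfold hsNorm
  exact (Finset.measurable_sum _ fun i _ => Finset.measurable_sum _ fun j _ =>
    (hA i j).pow_const 2).sqrt

lemma entry_le {d : ℕ} (M : Matrix (Fin d) (Fin d) ℝ) (i j : Fin d) : |M i j| ≤ hsNorm M := by
  unfold hsNorm
  apply Real.abs_le_sqrt
  calc M i j ^ 2 ≤ ∑ j, M i j ^ 2 :=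
        Finset.single_le_sum (f := fun j => M i j ^ 2) (fun _ _ => sq_nonneg _) (Finset.mem_univ j)
    _ ≤ _ := Finset.single_le_sum (f := fun i => ∑ j, M i j ^ 2)
        (fun _ _ => Finset.sum_nonneg fun _ _ => sq_nonneg _) (Finset.mem_univ i)

lemma hs_sub_sq {d : ℕ} (M K : Matrix (Fin d) (Fin d) ℝ) :
    hsNorm (M - K) ^ 2 ≤ 2 * hsNorm M ^ 2 + 2 * hsNorm K ^ 2 := by
  simp only [hsNorm_sq, Finset.mul_sum, ← Finset.sum_add_distrib]
  refine Finset.sum_le_sum fun i _ => Finset.sum_le_sum fun j _ => ?_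
  rw [Matrix.sub_apply]; nlinarith [sq_nonneg (M i j + K i j)]

lemma pow4_le (a b : ℝ) : (2 * a + 2 * b) ^ 4 ≤ 128 * a ^ 4 + 128 * b ^ 4 := by
  have h1 : (a + b) ^ 2 ≤ 2 * (a ^ 2 + b ^ 2) := by nlinarith [sq_nonneg (a - b)]
  have h2 : (a ^ 2 + b ^ 2) ^ 2 ≤ 2 * (a ^ 4 + b ^ 4) := by nlinarith [sq_nonneg (a ^ 2 - b ^ 2)]
  have h3 : ((a + b) ^ 2) ^ 2 ≤ (2 * (a ^ 2 + b ^ 2)) ^ 2 := by gcongr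
  nlinarith

lemma int8 {d : ℕ} {Ω : Type*} [MeasurableSpace Ω] (P : Measure Ω)
    [IsProbabilityMeasure P] (A : Ω → Matrix (Fin d) (Fin d) ℝ)
    (hA : ∀ i j, Measurable fun ω => A ω i j) (K : Matrix (Fin d) (Fin d) ℝ)
    (h8 : Integrable (fun ω => hsNorm (A ω) ^ 8) P) :
    Integrable (fun ω => hsNorm (A ω - K) ^ 8) P := by
  have hm : Measurable fun ω => hsNorm (A ω - K) :=
    hsNorm_meas fun i j => (hA i j).sub measurable_const
  refine Integrable.mono' ((h8.const_mul 128).add (integrable_const (128 * hsNorm K ^ 8)))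
    (hm.pow_const 8).aestronglyMeasurable (ae_of_all _ fun ω => ?_)
  have h0 := hsNorm_nonneg (A ω - K)
  rw [Real.norm_of_nonneg (by positivity)]
  calc hsNorm (A ω - K) ^ 8 = (hsNorm (A ω - K) ^ 2) ^ 4 := by ring
    _ ≤ (2 * hsNorm (A ω) ^ 2 + 2 * hsNorm K ^ 2) ^ 4 := by gcongr; exact hs_sub_sq _ _
    _ ≤ _ := pow4_le _ _
    _ = _ := by simp only [Pi.add_apply]; ring

lemma numeric {d : ℕ} (hd : 1 ≤ d) :
    1 / Real.sqrt 2 ≤ Real.sqrt ((Real.sqrt 3 / (24 * Real.sqrt 2)) * Cfac d) := by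
  apply Real.le_sqrt_of_sq_le
  rw [div_pow, Real.sq_sqrt (by norm_num)]
  have h6 : (2.4:ℝ) ≤ Real.sqrt 6 := Real.le_sqrt_of_sq_le (by norm_num)
  have h2 : (1.4:ℝ) ≤ Real.sqrt 2 := Real.le_sqrt_of_sq_le (by norm_num)
  have h2' : Real.sqrt 2 ≤ 1.42 := Real.sqrt_le_iff.2 (by norm_num)
  have h3 : (1.7:ℝ) ≤ Real.sqrt 3 := Real.le_sqrt_of_sq_le (by norm_num)
  have hdd : (1:ℝ) ≤ Real.sqrt d := Real.le_sqrt_of_sq_le (by simpa using hd)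
  have hC : (12:ℝ) ≤ Cfac d := by unfold Cfac; linarith
  have : (1.7:ℝ) / (24 * 1.42) ≤ Real.sqrt 3 / (24 * Real.sqrt 2) := by gcongr
  calc (1:ℝ)^2/2 ≤ 1.7 / (24 * 1.42) * 12 := by norm_num
    _ ≤ _ := by gcongr

lemma main_bound {d : ℕ} (hd : 1 ≤ d)
    {Ω : Type*} [mΩ : MeasurableSpace Ω] (P : Measure Ω) [IsProbabilityMeasure P]
    (K : Matrix (Fin d) (Fin d) ℝ) (hK : K.PosDef)
    (F : Ω → Fin d → ℝ) (m : {m : MeasurableSpace Ω // m ≤ mΩ})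
    (A : Ω → Matrix (Fin d) (Fin d) ℝ)
    (hFA : CondGaussian P F m.1 A)
    (hA8 : Integrable (fun ω => hsNorm (A ω) ^ 8) P) (B : Set (Fin d → ℝ)) (hB : MeasurableSet B) :
    0 < lambdaMin K ∧ |(P.map F).real B - (gaussLaw K).real B| ≤
      hsNorm K⁻¹ * hsNorm ((Matrix.of fun i j => ∫ ω, A ω i j ∂P) - K) / Real.sqrt 2 +
      6 / lambdaMin K ^ 2 * ∫ ω, hsNorm (A ω - K) ^ 2 ∂P := by
  obtain ⟨S, T, hS, hT, h1, h2, h3, h4⟩ := exists_sqrt hK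
  obtain ⟨hl, hb1, hb2⟩ := T_bounds hd hS hT h1 h2 h3 h4
  refine ⟨hl, ?_⟩
  obtain ⟨ρ, hρp, hρc, hρ⟩ := cond_law P F m A hFA
  obtain ⟨-, -, hpsd, hAm, -⟩ := hFA
  have hAe : ∀ i j, Measurable fun ω => A ω i j := fun i j =>
    (measurable_pi_apply j).comp ((measurable_pi_apply i).comp (hAm.mono m.2 le_rfl))
  have hAi : ∀ i j, Integrable (fun ω => A ω i j) P := fun i j =>
    ((jensen P _ (hsNorm_meas hAe).aestronglyMeasurable hA8).1).mono'
      (hAe i j).aestronglyMeasurable (ae_of_all _ fun ω => entry_le _ i j)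
  have hD : Measurable fun ω => hsNorm (A ω - K) :=
    hsNorm_meas fun i j => (hAe i j).sub measurable_const
  have hD2 := (jensen P _ hD.aestronglyMeasurable (int8 P A hAe K hA8)).2.1
  set B1 : Set (Fin d → ℝ) := (fun x => S.mulVec x) ⁻¹' B with hB1
  have hB1m : MeasurableSet B1 := meas_mulVec S hB
  have hKg : (gaussLaw K).real B = (gam d).real B1 := by
    rw [gaussLaw_eq hS hT h1 h2 h3 h4, map_measureReal_apply (meas_mulVec S) hB]
  have hTKT : T * K * T = 1 := by
    rw [← h1, ← Matrix.mul_assoc, h3, Matrix.one_mul, h2]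
  have hherm : ∀ H : Matrix (Fin d) (Fin d) ℝ, Hᵀ = H → (T * H * T).IsHermitian := by
    intro H hH
    change (T * H * T)ᴴ = _
    rw [conjTranspose_eq_transpose_of_trivial, transpose_mul, transpose_mul, hT, hH,
      Matrix.mul_assoc]
  have hKt : Kᵀ = K := by
    have := hK.1; rwa [IsHermitian, conjTranspose_eq_transpose_of_trivial] at this
  have hAt : ∀ ω, (A ω)ᵀ = A ω := fun ω => by
    have := (hpsd ω).1; rwa [IsHermitian, conjTranspose_eq_transpose_of_trivial] at this
  obtain ⟨hLi, hLe⟩ := lin_expect P A hAi K T B1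
  have pt : ∀ᵐ ω ∂P, |(ρ ω).real B - (gam d).real B1 -
      ∫ z in B1, qf (T * (A ω - K) * T) z ∂gam d| ≤ 6 / lambdaMin K ^ 2 * hsNorm (A ω - K) ^ 2 := by
    filter_upwards [hρc] with ω hω
    have := hρp ω
    have : IsProbabilityMeasure ((ρ ω).map (fun x => T.mulVec x)) :=
      Measure.isProbabilityMeasure_map (meas_mulVec T).aemeasurable
    have hg := hω.map T
    have e : T * A ω * Tᵀ = 1 + T * (A ω - K) * T := by
      rw [hT, Matrix.mul_sub, Matrix.sub_mul, hTKT]; abel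
    rw [e] at hg
    have hc := core (hherm (A ω - K) (by rw [transpose_sub, hAt, hKt])) _ hg B1 hB1m
    rw [map_measureReal_apply (meas_mulVec T) hB1m] at hc
    have eB : (fun x => T.mulVec x) ⁻¹' B1 = B := by
      ext x; simp [hB1, mulVec_mulVec, h2]
    rw [eB] at hc
    refine hc.trans ?_
    have := hs_conj hT (inv_nonneg.2 hl.le) hb2 (A ω - K)
    have h0 := hsNorm_nonneg (T * (A ω - K) * T)
    calc 6 * hsNorm (T * (A ω - K) * T) ^ 2 ≤ 6 * ((lambdaMin K)⁻¹ * hsNorm (A ω - K)) ^ 2 := by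
          gcongr
      _ = _ := by field_simp
  have hintg : Integrable (fun ω => (ρ ω).real B - (gam d).real B1 -
      ∫ z in B1, qf (T * (A ω - K) * T) z ∂gam d) P :=
    ((hρ B hB).1.sub (integrable_const _)).sub hLi
  have e1 : ∫ ω, ((ρ ω).real B - (gam d).real B1 -
      ∫ z in B1, qf (T * (A ω - K) * T) z ∂gam d) ∂P = (P.map F).real B - (gaussLaw K).real B -
      ∫ z in B1, qf (T * ((Matrix.of fun i j => ∫ ω, A ω i j ∂P) - K) * T) z ∂gam d := by
    have hi1 : Integrable (fun ω => (ρ ω).real B - (gam d).real B1) P :=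
      (hρ B hB).1.sub (integrable_const _)
    rw [integral_sub hi1 hLi,
      integral_sub (hρ B hB).1 (integrable_const _), hLe, (hρ B hB).2, hKg]
    simp
  have e2 : |∫ ω, ((ρ ω).real B - (gam d).real B1 -
      ∫ z in B1, qf (T * (A ω - K) * T) z ∂gam d) ∂P| ≤
      6 / lambdaMin K ^ 2 * ∫ ω, hsNorm (A ω - K) ^ 2 ∂P := by
    rw [← integral_const_mul]
    exact (abs_integral_le_integral_abs).trans
      (integral_mono_ae hintg.abs (hD2.const_mul _) pt)
  rw [e1] at e2
  have e3 := lin_bound (hherm ((Matrix.of fun i j => ∫ ω, A ω i j ∂P) - K) (by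
    rw [transpose_sub, hKt]; congr 1; ext i j
    simp only [transpose_apply, of_apply]
    congr 1; ext ω
    exact congrFun (congrFun (hAt ω) i) j)) B1 hB1m
  have e4 := hs_conj hT (hsNorm_nonneg _) hb1 ((Matrix.of fun i j => ∫ ω, A ω i j ∂P) - K)
  have e5 := div_le_div_of_nonneg_right e4 (Real.sqrt_nonneg 2)
  rw [abs_le] at *
  constructor <;> linarith [e2.1, e2.2, e3.1, e3.2]

theorem aux_bound
    {d : ℕ} (hd : 1 ≤ d)
    {Ω : Type*} [mΩ : MeasurableSpace Ω] (P : Measure Ω) [IsProbabilityMeasure P]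
    (K : Matrix (Fin d) (Fin d) ℝ) (hK : K.PosDef)
    (G F : Ω → Fin d → ℝ) (hG : Measure.map G P = gaussLaw K)
    (𝓕 : {m : MeasurableSpace Ω // m ≤ mΩ})
    (A : Ω → Matrix (Fin d) (Fin d) ℝ)
    (hFA : CondGaussian P F 𝓕.1 A)
    (hA8 : Integrable (fun ω => hsNorm (A ω) ^ 8) P) (Z : ℝ) :
    dTV (Measure.map F P) (Measure.map G P) ≤
      Real.sqrt ((Real.sqrt 3 / (24 * Real.sqrt 2)) * Cfac d) * hsNorm K⁻¹ *
        hsNorm ((Matrix.of fun i j => ∫ ω, A ω i j ∂P) - K)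
      + ( Real.sqrt Z
        + 8 / lambdaMin K ^ 2 ) *
        (∫ ω, hsNorm (A ω - K) ^ 8 ∂P) ^ ((1 : ℝ) / 4) := by
  unfold dTV
  refine csSup_le ⟨_, ∅, MeasurableSet.empty, rfl⟩ ?_
  rintro r ⟨B, hB, rfl⟩
  rw [hG]
  obtain ⟨hl, h⟩ := main_bound hd P K hK F 𝓕 A hFA hA8 B hB
  have hAe : ∀ i j, Measurable fun ω => A ω i j := fun i j =>
    (measurable_pi_apply j).comp ((measurable_pi_apply i).comp (hFA.2.2.2.1.mono 𝓕.2 le_rfl))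
  have hD : Measurable fun ω => hsNorm (A ω - K) :=
    hsNorm_meas fun i j => (hAe i j).sub measurable_const
  have hj := (jensen P _ hD.aestronglyMeasurable (int8 P A hAe K hA8)).2.2
  refine h.trans (add_le_add ?_ ?_)
  · have := mul_le_mul_of_nonneg_right (numeric hd) (mul_nonneg (hsNorm_nonneg K⁻¹)
      (hsNorm_nonneg ((Matrix.of fun i j => ∫ ω, A ω i j ∂P) - K)))
    calc _ = 1 / Real.sqrt 2 * (hsNorm K⁻¹ *
          hsNorm ((Matrix.of fun i j => ∫ ω, A ω i j ∂P) - K)) := by ring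
      _ ≤ _ := this
      _ = _ := by ring
  · have n2 : 0 ≤ ∫ ω, hsNorm (A ω - K) ^ 2 ∂P := integral_nonneg fun _ => sq_nonneg _
    refine mul_le_mul ?_ hj n2 (by positivity)
    have : 6 / lambdaMin K ^ 2 ≤ 8 / lambdaMin K ^ 2 := by gcongr; norm_num
    linarith [Real.sqrt_nonneg Z]


end Aux

/-- Theorem `th_dis_nuo`, TV part: explicit total variation bound. -/
theorem statement_2
    {d : ℕ} (hd : 1 ≤ d)
    {Ω : Type*} [mΩ : MeasurableSpace Ω] (P : Measure Ω) [IsProbabilityMeasure P]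
    (K : Matrix (Fin d) (Fin d) ℝ) (hK : K.PosDef)
    (G F : Ω → Fin d → ℝ) (hG : Measure.map G P = gaussLaw K)
    (𝓕 : {m : MeasurableSpace Ω // m ≤ mΩ})
    (A : Ω → Matrix (Fin d) (Fin d) ℝ)
    (hFA : CondGaussian P F 𝓕.1 A)
    (hA8 : Integrable (fun ω => hsNorm (A ω) ^ 8) P) :
    dTV (Measure.map F P) (Measure.map G P) ≤
      Real.sqrt ((Real.sqrt 3 / (24 * Real.sqrt 2)) * Cfac d) * hsNorm K⁻¹ *
        hsNorm ((Matrix.of fun i j => ∫ ω, A ω i j ∂P) - K)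
      + ( Real.sqrt
            ( (Real.sqrt 2 / (2 * lambdaMin K ^ 4 * Real.sqrt 3)) * Cfac d *
                hsNorm K⁻¹ ^ 2 * (lambdaMin K ^ 2 + 4 * hsNorm K ^ 2)
            + (Real.sqrt 70 * (d : ℝ) ^ 2 / (2 * lambdaMin K ^ 4)) *
                ((1/2) * maxLog K + (Real.sqrt 2 + 1) * (d : ℝ) / 4)
            + (3 + Real.sqrt 3 / 8 + 5 * Real.sqrt 10 + 4 * Real.sqrt 30 / 3
                + Real.sqrt 15 / 3 + 10 * Real.sqrt 5 / 3) * (d : ℝ) ^ 2 /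
                  (2 * lambdaMin K ^ 4) )
        + 8 / lambdaMin K ^ 2 ) *
        (∫ ω, hsNorm (A ω - K) ^ 8 ∂P) ^ ((1 : ℝ) / 4) := by
  exact aux_bound hd P K hK G F hG 𝓕 A hFA hA8 _
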